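/- Let Θ ⊆ I. For every ∼_Θ-equivalence class on W × W there exist unique elements w₁ ∈ W^{Θ∪Θ^⊥}, w₂ ∈ W_{Θ^⊥}, w₃ ∈ ^{Θ∪Θ^⊥}W such that the pair (w₁w₂, w₃) belongs to the class; moreover (w₁w₂, w₃) ∼_Θ (w₁, w₂w₃) (normal form III). -/

import Mathlib

open Classical

namespace Paper

variable {B : Type*} {M : CoxeterMatrix B} {W : Type*} [Group W]

/-- `Θ^⊥`: the indices whose simple reflections commute with all simple
reflections indexed by `Θ` (i.e. `m(i,j) = 2` for all `j ∈ Θ`). -/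
def perp (M : CoxeterMatrix B) (Θ : Set B) : Set B := {i | i ∉ Θ ∧ ∀ j ∈ Θ, M i j = 2}

variable (cs : CoxeterSystem M W)

/-- The standard parabolic subgroup `W_J` generated by the simple reflections indexed by `J`. -/
def parabolic (J : Set B) : Subgroup W := Subgroup.closure (cs.simple '' J)

/-- `W^J`: the minimal-length representatives of the cosets `W/W_J`,
`{w : ℓ(wu) = ℓ(w) + ℓ(u) for all u ∈ W_J}`. -/
def minRight (J : Set B) : Set W :=
  {w | ∀ u ∈ parabolic cs J, cs.length (w * u) = cs.length w + cs.length u}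

/-- `^JW`: the minimal-length representatives of the cosets `W_J\W`,
`{w : ℓ(uw) = ℓ(u) + ℓ(w) for all u ∈ W_J}`. -/
def minLeft (J : Set B) : Set W :=
  {w | ∀ u ∈ parabolic cs J, cs.length (u * w) = cs.length u + cs.length w}

/-- The Bruhat order on `W`: `x ≤ y` iff `y` is obtained from `x` by a chain of
right multiplications by reflections, each strictly increasing the length. -/
def bruhatLE : W → W → Prop :=
  Relation.ReflTransGen (fun x y => ∃ t, cs.IsReflection t ∧ y = x * t ∧ cs.length x < cs.length y)

/-- The equivalence relation `∼_Θ` on `W × W`: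
`(x,y) ∼_Θ (x',y')` iff there are `u ∈ W_{Θ∪Θ^⊥}` and `v ∈ W_Θ` with `x' = xu`, `y' = u⁻¹vy`. -/
def simRel (Θ : Set B) (p q : W × W) : Prop :=
  ∃ u ∈ parabolic cs (Θ ∪ perp M Θ), ∃ v ∈ parabolic cs Θ,
    q.1 = p.1 * u ∧ q.2 = u⁻¹ * v * p.2

/-- `w^J`: the minimal-length element of the coset `w W_J`. -/
noncomputable def projR (J : Set B) (w : W) : W :=
  if h : ∃ a, a ∈ minRight cs J ∧ a⁻¹ * w ∈ parabolic cs J then h.choose else w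

/-- `^Jw`: the minimal-length element of the coset `W_J w`. -/
noncomputable def projL (J : Set B) (w : W) : W :=
  if h : ∃ a, a ∈ minLeft cs J ∧ w * a⁻¹ ∈ parabolic cs J then h.choose else w

/-! ### Distinct indices give distinct simple reflections -/

/-- The linear form pairing with the simple root `i` in the geometric representation. -/
noncomputable def coroot (M : CoxeterMatrix B) (i : B) : Module.Dual ℝ (B →₀ ℝ) :=
  Finsupp.linearCombination ℝ fun j => -2 * Real.cos (Real.pi / M i j)

lemma coroot_single (M : CoxeterMatrix B) (i j : B) :
    coroot M i (Finsupp.single j 1) = -2 * Real.cos (Real.pi / M i j) := by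
  simp [coroot]

lemma coroot_single_self (M : CoxeterMatrix B) (i : B) :
    coroot M i (Finsupp.single i 1) = 2 := by
  simp [coroot_single]

/-- The action of a simple reflection in the geometric representation. -/
noncomputable def geomReflection (M : CoxeterMatrix B) (i : B) : (B →₀ ℝ) ≃ₗ[ℝ] (B →₀ ℝ) :=
  Module.reflection (coroot_single_self M i)

lemma sin_two_pi_div_ne_zero {m : ℕ} (hm : 3 ≤ m) : Real.sin (2 * Real.pi / m) ≠ 0 := by
  have hm' : (3 : ℝ) ≤ m := by exact_mod_cast hm
  apply ne_of_gt
  apply Real.sin_pos_of_pos_of_lt_pi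
  · positivity
  · rw [div_lt_iff₀ (by positivity)]
    nlinarith [Real.pi_pos]

lemma eval_S_eq_zero {m : ℕ} (hm : 3 ≤ m) {k : ℤ} (hk : 2 * (k + 1) = m) :
    (Polynomial.Chebyshev.S ℝ k).eval (2 * Real.cos (2 * Real.pi / m)) = 0 := by
  have hm' : (m : ℝ) ≠ 0 := by
    norm_cast
    omega
  have h := Polynomial.Chebyshev.S_two_mul_real_cos (2 * Real.pi / m) k
  have h2 : ((k : ℝ) + 1) * (2 * Real.pi / m) = Real.pi := by
    have : 2 * ((k : ℝ) + 1) = m := by exact_mod_cast hk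
    field_simp
    linarith
  rw [h2, Real.sin_pi] at h
  exact (mul_eq_zero.mp h).resolve_right (sin_two_pi_div_ne_zero hm)

lemma eval_S_add_eval_S_eq_zero {m : ℕ} (hm : 3 ≤ m) {k : ℤ} (hk : 2 * k + 1 = m) :
    (Polynomial.Chebyshev.S ℝ k).eval (2 * Real.cos (2 * Real.pi / m)) +
      (Polynomial.Chebyshev.S ℝ (k - 1)).eval (2 * Real.cos (2 * Real.pi / m)) = 0 := by
  have hm' : (m : ℝ) ≠ 0 := by
    norm_cast
    omega
  have h := Polynomial.Chebyshev.S_two_mul_real_cos (2 * Real.pi / m) k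
  have h' := Polynomial.Chebyshev.S_two_mul_real_cos (2 * Real.pi / m) (k - 1)
  have h2 : ((k : ℝ) + 1) * (2 * Real.pi / m) =
      2 * Real.pi - (((k - 1 : ℤ) : ℝ) + 1) * (2 * Real.pi / m) := by
    have : 2 * (k : ℝ) + 1 = m := by exact_mod_cast hk
    push_cast
    field_simp
    linarith
  rw [h2, Real.sin_two_pi_sub] at h
  refine (mul_eq_zero.mp ?_).resolve_right (sin_two_pi_div_ne_zero hm)
  rw [add_mul, h, h', neg_add_cancel]

lemma isLiftable_geomReflection (M : CoxeterMatrix B) : M.IsLiftable (geomReflection M) := by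
  intro i j
  by_cases hij : i = j
  · subst hij
    have : geomReflection M i * geomReflection M i = 1 :=
      LinearEquiv.ext fun z => Module.involutive_reflection (coroot_single_self M i) z
    rw [this, one_pow]
  have h1 : M i j ≠ 1 := M.off_diagonal i j hij
  ext1 z
  obtain ⟨m, hm⟩ : ∃ m, m = M i j := ⟨_, rfl⟩
  have hf : coroot M i (Finsupp.single j 1) = -2 * Real.cos (Real.pi / m) := by
    rw [coroot_single, hm]
  have hg : coroot M j (Finsupp.single i 1) = -2 * Real.cos (Real.pi / m) := by
    rw [coroot_single, M.symmetric j i, hm]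
  rw [← hm] at h1 ⊢
  have ht : 2 * Real.cos (2 * Real.pi / m) =
      coroot M i (Finsupp.single j 1) * coroot M j (Finsupp.single i 1) - 2 := by
    rw [hf, hg, mul_div_assoc, Real.cos_two_mul]
    ring
  rw [geomReflection, geomReflection,
    Module.reflection_mul_reflection_pow_apply _ _ m z _ ht]
  change _ = z
  rcases (by omega : m = 0 ∨ m = 2 ∨ 3 ≤ m) with rfl | rfl | h3
  · simp
  · rw [hf, hg]
    norm_num
    abel
  · rcases Nat.even_or_odd' m with ⟨k, hk | hk⟩
    · have e1 : ((m : ℤ) - 2) / 2 = k - 1 := by omega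
      have e2 : ((m : ℤ) - 1) / 2 = k - 1 := by omega
      have e0 := eval_S_eq_zero h3 (k := (k : ℤ) - 1) (by omega)
      rw [e1, e2, e0]
      simp
    · have e1 : ((m : ℤ) - 2) / 2 = k - 1 := by omega
      have e2 : ((m : ℤ) - 1) / 2 = k := by omega
      have e3 : ((m : ℤ) - 3) / 2 = k - 1 := by omega
      have e4 : (m : ℤ) / 2 = k := by omega
      have e0 := eval_S_add_eval_S_eq_zero h3 (k := (k : ℤ)) (by omega)
      rw [e1, e2, e3, e4, e0]
      simp

lemma simple_injective : Function.Injective cs.simple := by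
  intro i j h
  by_contra hij
  have h1 : geomReflection M i = geomReflection M j := by
    rw [← cs.lift_apply_simple (isLiftable_geomReflection M) i,
      ← cs.lift_apply_simple (isLiftable_geomReflection M) j, h]
  have h2 := congrArg (fun v : B →₀ ℝ => v i) (LinearEquiv.congr_fun h1 (Finsupp.single i 1))
  simp [geomReflection, Module.reflection_apply, coroot_single, Ne.symm hij] at h2
  norm_num at h2

/-! ### The inversion cocycle and the exchange property -/

/-- The action of a simple reflection on `W × ZMod 2`: conjugation on the first factor, and
a sign change exactly when the first component is that reflection. -/
noncomputable def signPerm (i : B) : Equiv.Perm (W × ZMod 2) :=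
  Function.Involutive.toPerm
    (fun a => (cs.simple i * a.1 * cs.simple i, a.2 + if a.1 = cs.simple i then 1 else 0)) (by
      rintro ⟨t, e⟩
      have h : cs.simple i * t * cs.simple i = cs.simple i ↔ t = cs.simple i := by
        constructor
        · intro h
          have := congrArg (fun x => cs.simple i * x * cs.simple i) h
          simpa [mul_assoc] using this
        · rintro rfl
          simp
      ext
      · simp [mul_assoc]
      · simp only [h, add_assoc, CharTwo.add_self_eq_zero, add_zero])

lemma signPerm_apply (i : B) (t : W) (e : ZMod 2) :
    signPerm cs i (t, e) =
      (cs.simple i * t * cs.simple i, e + if t = cs.simple i then 1 else 0) := rfl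

lemma pow_mul_simple_mul_pow (i j : B) (n : ℕ) :
    (cs.simple i * cs.simple j) ^ n * cs.simple j * (cs.simple i * cs.simple j) ^ n =
      cs.simple j := by
  induction n with
  | zero => simp
  | succ n ih =>
    calc _ = (cs.simple i * cs.simple j) * ((cs.simple i * cs.simple j) ^ n * cs.simple j *
          (cs.simple i * cs.simple j) ^ n) * (cs.simple i * cs.simple j) := by
            rw [pow_succ']
            nth_rewrite 2 [← pow_succ']
            rw [pow_succ]
            simp only [mul_assoc]
      _ = _ := by
        rw [ih]
        simp [mul_assoc]

lemma signPerm_mul_pow_apply (i j : B) (n : ℕ) (t : W) (e : ZMod 2) :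
    ((signPerm cs i * signPerm cs j) ^ n) (t, e) =
      ((cs.simple i * cs.simple j) ^ n * t * ((cs.simple i * cs.simple j) ^ n)⁻¹,
        e + ∑ k ∈ Finset.range (2 * n),
          if t = cs.simple j * (cs.simple i * cs.simple j) ^ k then 1 else 0) := by
  induction n with
  | zero => simp
  | succ n ih =>
    have key := pow_mul_simple_mul_pow cs i j n
    have h1 : (cs.simple i * cs.simple j) ^ n * t * ((cs.simple i * cs.simple j) ^ n)⁻¹ =
        cs.simple j ↔ t = cs.simple j * (cs.simple i * cs.simple j) ^ (2 * n) := by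
      rw [mul_inv_eq_iff_eq_mul, two_mul, pow_add]
      nth_rewrite 2 [← key]
      simp only [mul_assoc, mul_right_inj]
    have h2 : cs.simple j * ((cs.simple i * cs.simple j) ^ n * t *
        ((cs.simple i * cs.simple j) ^ n)⁻¹) * cs.simple j = cs.simple i ↔
        t = cs.simple j * (cs.simple i * cs.simple j) ^ (2 * n + 1) := by
      have : cs.simple j * ((cs.simple i * cs.simple j) ^ n * t *
          ((cs.simple i * cs.simple j) ^ n)⁻¹) * cs.simple j = cs.simple i ↔
          (cs.simple i * cs.simple j) ^ n * t * ((cs.simple i * cs.simple j) ^ n)⁻¹ =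
            cs.simple j * (cs.simple i * cs.simple j) := by
        rw [← eq_mul_inv_iff_mul_eq, ← eq_inv_mul_iff_mul_eq, cs.inv_simple]
      rw [this, mul_inv_eq_iff_eq_mul, (by ring : 2 * n + 1 = n + (1 + n)), pow_add, pow_add,
        pow_one]
      nth_rewrite 2 [← key]
      simp only [mul_assoc, mul_right_inj]
    rw [pow_succ', Equiv.Perm.mul_apply, ih, Equiv.Perm.mul_apply, signPerm_apply,
      signPerm_apply, h1, h2, (by ring : 2 * (n + 1) = 2 * n + 1 + 1), Finset.sum_range_succ,
      Finset.sum_range_succ]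
    ext
    · simp [pow_succ', mul_assoc]
    · simp only [add_assoc]

lemma isLiftable_signPerm : M.IsLiftable (signPerm cs) := by
  intro i j
  ext1 ⟨t, e⟩
  rw [signPerm_mul_pow_apply, two_mul, Finset.sum_range_add]
  simp only [pow_add, cs.simple_mul_simple_pow, one_mul, CharTwo.add_self_eq_zero]
  simp

/-- The inversion cocycle, with `invCocycle w t = 1` iff `t` is a right inversion of `w`. -/
noncomputable def invCocycle (w t : W) : ZMod 2 :=
  (cs.lift ⟨signPerm cs, isLiftable_signPerm cs⟩ w (t, 0)).2

lemma lift_signPerm_apply (w t : W) (e : ZMod 2) :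
    cs.lift ⟨signPerm cs, isLiftable_signPerm cs⟩ w (t, e) =
      (w * t * w⁻¹, e + invCocycle cs w t) := by
  induction w using cs.simple_induction_left generalizing e with
  | one => simp [invCocycle]
  | mul_simple_left w i ih =>
    rw [invCocycle, map_mul, Equiv.Perm.mul_apply, Equiv.Perm.mul_apply, ih, ih,
      cs.lift_apply_simple (isLiftable_signPerm cs), signPerm_apply, signPerm_apply]
    simp [mul_assoc, add_assoc]

lemma invCocycle_mul (w w' t : W) :
    invCocycle cs (w * w') t = invCocycle cs w' t + invCocycle cs w (w' * t * w'⁻¹) := by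
  rw [invCocycle, map_mul, Equiv.Perm.mul_apply, lift_signPerm_apply, lift_signPerm_apply,
    zero_add]

lemma invCocycle_one (t : W) : invCocycle cs 1 t = 0 := by
  simp [invCocycle]

lemma invCocycle_simple (i : B) (t : W) :
    invCocycle cs (cs.simple i) t = if t = cs.simple i then 1 else 0 := by
  rw [invCocycle, cs.lift_apply_simple (isLiftable_signPerm cs), signPerm_apply, zero_add]

lemma exists_sublist_of_invCocycle_ne_zero (ω : List B) (t : W)
    (h : invCocycle cs (cs.wordProd ω) t ≠ 0) :
    ∃ ω' : List B, ω'.Sublist ω ∧ ω'.length < ω.length ∧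
      cs.wordProd ω' = cs.wordProd ω * t := by
  induction ω with
  | nil => simp [invCocycle_one] at h
  | cons i ω ih =>
    rw [cs.wordProd_cons, invCocycle_mul, invCocycle_simple] at h
    by_cases h0 : invCocycle cs (cs.wordProd ω) t = 0
    · rw [h0, zero_add] at h
      have h1 : cs.wordProd ω * t * (cs.wordProd ω)⁻¹ = cs.simple i := by
        by_contra hne
        simp [hne] at h
      refine ⟨ω, List.sublist_cons_self i ω, by simp, ?_⟩
      rw [cs.wordProd_cons, mul_assoc, mul_inv_eq_iff_eq_mul.mp h1,
        cs.simple_mul_simple_cancel_left]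
    · obtain ⟨ω', hs, hl, hp⟩ := ih h0
      refine ⟨i :: ω', hs.cons_cons i, by simpa using hl, ?_⟩
      rw [cs.wordProd_cons, cs.wordProd_cons, hp, mul_assoc]

lemma length_mul_lt_of_invCocycle_ne_zero {w t : W} (h : invCocycle cs w t ≠ 0) :
    cs.length (w * t) < cs.length w := by
  obtain ⟨ω, hω, rfl⟩ := cs.exists_isReduced w
  obtain ⟨ω', -, hl, hp⟩ := exists_sublist_of_invCocycle_ne_zero cs ω t h
  rw [← hp, hω.eq]
  exact (cs.length_wordProd_le ω').trans_lt hl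

lemma invCocycle_ne_zero_of_isRightDescent {w : W} {i : B} (h : cs.IsRightDescent w i) :
    invCocycle cs w (cs.simple i) ≠ 0 := by
  intro h0
  have h1 : invCocycle cs (w * cs.simple i) (cs.simple i) ≠ 0 := by
    rw [invCocycle_mul, invCocycle_simple]
    simp [h0]
  have h2 := length_mul_lt_of_invCocycle_ne_zero cs h1
  rw [cs.simple_mul_simple_cancel_right] at h2
  exact absurd h (not_lt_of_gt h2)

/-! ### Parabolic subgroups and minimal coset representatives -/

lemma simple_mem_parabolic {J : Set B} {i : B} (hi : i ∈ J) : cs.simple i ∈ parabolic cs J :=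
  Subgroup.subset_closure ⟨i, hi, rfl⟩

lemma wordProd_mem_parabolic {J : Set B} {ω : List B} (h : ∀ i ∈ ω, i ∈ J) :
    cs.wordProd ω ∈ parabolic cs J := by
  refine Subgroup.list_prod_mem _ fun x hx => ?_
  obtain ⟨i, hi, rfl⟩ := List.mem_map.mp hx
  exact simple_mem_parabolic cs (h i hi)

lemma exists_word_of_mem_parabolic {J : Set B} {u : W} (hu : u ∈ parabolic cs J) :
    ∃ ω : List B, (∀ i ∈ ω, i ∈ J) ∧ cs.wordProd ω = u := by
  induction hu using Subgroup.closure_induction with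
  | mem x hx =>
    obtain ⟨i, hi, rfl⟩ := hx
    exact ⟨[i], by simpa using hi, by simp⟩
  | one => exact ⟨[], by simp, by simp⟩
  | mul x y _ _ hx hy =>
    obtain ⟨ω, h, rfl⟩ := hx
    obtain ⟨ω', h', rfl⟩ := hy
    refine ⟨ω ++ ω', fun i hi => ?_, cs.wordProd_append ω ω'⟩
    exact (List.mem_append.mp hi).elim (h i) (h' i)
  | inv x _ hx =>
    obtain ⟨ω, h, rfl⟩ := hx
    exact ⟨ω.reverse, fun i hi => h i (List.mem_reverse.mp hi), cs.wordProd_reverse ω⟩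

/-- A word of minimal length among the `J`-words with the same product stays reduced after
multiplication on the left by a shortest element of a coset of `W_J`. -/
lemma length_mul_wordProd {J : Set B} {a : W}
    (ha : ∀ u ∈ parabolic cs J, cs.length a ≤ cs.length (a * u)) (ω : List B)
    (hω : ∀ i ∈ ω, i ∈ J)
    (hmin : ∀ ω' : List B, (∀ i ∈ ω', i ∈ J) → cs.wordProd ω' = cs.wordProd ω →
      ω.length ≤ ω'.length) :
    cs.length (a * cs.wordProd ω) = cs.length a + ω.length := by
  induction ω using List.reverseRecOn with
  | nil => simp
  | append_singleton ω j ih =>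
    have hωJ : ∀ i ∈ ω, i ∈ J := fun i hi => hω i (by simp [hi])
    have hj : j ∈ J := hω j (by simp)
    rw [cs.wordProd_append, cs.wordProd_singleton] at hmin ⊢
    have ih' := ih hωJ fun ω' h' hp => by
      have := hmin (ω' ++ [j]) (fun i hi => by
        rcases List.mem_append.mp hi with hi | hi
        · exact h' i hi
        · rwa [List.mem_singleton.mp hi]) (by
          rw [cs.wordProd_append, cs.wordProd_singleton, hp])
      simpa using this
    have hnd : ¬ cs.IsRightDescent (a * cs.wordProd ω) j := by
      intro hd
      have hne := invCocycle_ne_zero_of_isRightDescent cs hd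
      rw [invCocycle_mul] at hne
      by_cases h0 : invCocycle cs (cs.wordProd ω) (cs.simple j) = 0
      · rw [h0, zero_add] at hne
        have hlt := length_mul_lt_of_invCocycle_ne_zero cs hne
        have hm := wordProd_mem_parabolic cs hωJ
        exact absurd hlt (not_lt_of_ge (ha _ (mul_mem (mul_mem hm
          (simple_mem_parabolic cs hj)) (inv_mem hm))))
      · obtain ⟨ω', hs, hl, hp⟩ := exists_sublist_of_invCocycle_ne_zero cs ω _ h0
        have := hmin ω' (fun i hi => hωJ i (hs.subset hi)) hp
        simp only [List.length_append, List.length_singleton] at this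
        omega
    rw [← mul_assoc, (cs.not_isRightDescent_iff).mp hnd, ih', List.length_append,
      List.length_singleton, add_assoc]

lemma exists_minimal_word {J : Set B} {u : W} (hu : u ∈ parabolic cs J) :
    ∃ ω : List B, (∀ i ∈ ω, i ∈ J) ∧ cs.wordProd ω = u ∧
      ∀ ω' : List B, (∀ i ∈ ω', i ∈ J) → cs.wordProd ω' = cs.wordProd ω →
        ω.length ≤ ω'.length := by
  obtain ⟨ω, ⟨h, hp⟩, hmin⟩ := exists_minimalFor_of_wellFoundedLT
    (fun ω : List B => (∀ i ∈ ω, i ∈ J) ∧ cs.wordProd ω = u) List.length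
    (exists_word_of_mem_parabolic cs hu)
  refine ⟨ω, h, hp, fun ω' h' hp' => ?_⟩
  exact (le_total ω.length ω'.length).elim id (hmin ⟨h', hp'.trans hp⟩)

lemma exists_isReduced_of_mem_parabolic {J : Set B} {u : W} (hu : u ∈ parabolic cs J) :
    ∃ ω : List B, (∀ i ∈ ω, i ∈ J) ∧ cs.wordProd ω = u ∧ cs.IsReduced ω := by
  obtain ⟨ω, h, hp, hmin⟩ := exists_minimal_word cs hu
  refine ⟨ω, h, hp, ?_⟩
  simpa [CoxeterSystem.IsReduced] using length_mul_wordProd cs (a := 1) (by simp) ω h hmin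

lemma exists_mul_of_minRight (J : Set B) (w : W) :
    ∃ a ∈ minRight cs J, ∃ u ∈ parabolic cs J, w = a * u := by
  obtain ⟨a, ha, hmin⟩ := exists_minimalFor_of_wellFoundedLT
    (fun a : W => a⁻¹ * w ∈ parabolic cs J) cs.length ⟨w, by simp⟩
  refine ⟨a, fun u hu => ?_, a⁻¹ * w, ha, by simp⟩
  have hmin' : ∀ u ∈ parabolic cs J, cs.length a ≤ cs.length (a * u) := fun u hu =>
    (le_total _ _).elim id (hmin (by
      change (a * u)⁻¹ * w ∈ parabolic cs J
      rw [mul_inv_rev, mul_assoc]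
      exact mul_mem (inv_mem hu) ha))
  obtain ⟨ω, h, rfl, hω⟩ := exists_minimal_word cs hu
  rw [length_mul_wordProd cs hmin' ω h hω]
  simpa using (length_mul_wordProd cs (a := 1) (by simp) ω h hω).symm

lemma mem_minLeft_iff_inv {J : Set B} {w : W} : w ∈ minLeft cs J ↔ w⁻¹ ∈ minRight cs J := by
  have key (u : W) : cs.length (w⁻¹ * u⁻¹) = cs.length (u * w) := by
    rw [← mul_inv_rev, cs.length_inv]
  constructor
  · intro h u hu
    simpa [h _ (inv_mem hu), add_comm] using key u⁻¹
  · intro h u hu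
    have := h _ (inv_mem hu)
    rw [key, cs.length_inv, cs.length_inv] at this
    rw [this, add_comm]

lemma exists_mul_of_minLeft (J : Set B) (w : W) :
    ∃ u ∈ parabolic cs J, ∃ a ∈ minLeft cs J, w = u * a := by
  obtain ⟨a, ha, u, hu, h⟩ := exists_mul_of_minRight cs J w⁻¹
  refine ⟨u⁻¹, inv_mem hu, a⁻¹, by rwa [mem_minLeft_iff_inv, inv_inv], ?_⟩
  rw [← mul_inv_rev, ← h, inv_inv]

lemma eq_of_mem_minRight {J : Set B} {a b : W} (ha : a ∈ minRight cs J)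
    (hb : b ∈ minRight cs J) (h : a⁻¹ * b ∈ parabolic cs J) : a = b := by
  have h1 := ha _ h
  have h2 := hb _ (inv_mem h)
  simp only [mul_inv_rev, inv_inv, mul_inv_cancel_left] at h1 h2
  have h3 : cs.length (a⁻¹ * b) = 0 := by omega
  exact inv_mul_eq_one.mp (cs.length_eq_zero_iff.mp h3)

lemma eq_of_mem_minLeft {J : Set B} {a b : W} (ha : a ∈ minLeft cs J)
    (hb : b ∈ minLeft cs J) (h : a * b⁻¹ ∈ parabolic cs J) : a = b := by
  rw [mem_minLeft_iff_inv] at ha hb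
  exact inv_injective (eq_of_mem_minRight cs ha hb (by rwa [inv_inv]))

lemma simple_mem_parabolic_iff {J : Set B} {i : B} :
    cs.simple i ∈ parabolic cs J ↔ i ∈ J := by
  refine ⟨fun h => ?_, simple_mem_parabolic cs⟩
  obtain ⟨ω, hJ, hp, hω⟩ := exists_isReduced_of_mem_parabolic cs h
  have hl : ω.length = 1 := by rw [← hω.eq, hp, cs.length_simple]
  obtain ⟨j, rfl⟩ := List.length_eq_one_iff.mp hl
  rw [cs.wordProd_singleton] at hp
  rw [← simple_injective cs hp]
  exact hJ j (by simp)

lemma mem_of_isRightDescent {J : Set B} {u : W} (hu : u ∈ parabolic cs J) {i : B}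
    (hi : cs.IsRightDescent u i) : i ∈ J := by
  obtain ⟨ω, hJ, rfl⟩ := exists_word_of_mem_parabolic cs hu
  obtain ⟨ω', hs, -, hp⟩ := exists_sublist_of_invCocycle_ne_zero cs ω _
    (invCocycle_ne_zero_of_isRightDescent cs hi)
  have h := wordProd_mem_parabolic cs fun i hi => hJ i (hs.subset hi)
  rw [hp] at h
  exact (simple_mem_parabolic_iff cs).mp ((Subgroup.mul_mem_cancel_left _ hu).mp h)

lemma eq_one_of_mem_parabolic_of_disjoint {J K : Set B} (hJK : Disjoint J K) {u : W}
    (hJ : u ∈ parabolic cs J) (hK : u ∈ parabolic cs K) : u = 1 := by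
  by_contra hne
  obtain ⟨i, hi⟩ := cs.exists_rightDescent_of_ne_one hne
  exact Set.disjoint_left.mp hJK (mem_of_isRightDescent cs hJ hi) (mem_of_isRightDescent cs hK hi)

/-! ### The parabolic subgroup of `Θ ∪ Θ^⊥` -/

lemma disjoint_perp (M : CoxeterMatrix B) (Θ : Set B) : Disjoint Θ (perp M Θ) :=
  Set.disjoint_right.mpr fun _ hi => hi.1

lemma commute_of_mem_parabolic_perp {Θ : Set B} {a b : W} (ha : a ∈ parabolic cs Θ)
    (hb : b ∈ parabolic cs (perp M Θ)) : Commute a b := by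
  have hs : ∀ j ∈ Θ, ∀ i ∈ perp M Θ, Commute (cs.simple j) (cs.simple i) := by
    intro j hj i hi
    have h := cs.simple_mul_simple_pow i j
    rw [hi.2 j hj, pow_two, mul_eq_one_iff_eq_inv, mul_inv_rev, cs.inv_simple,
      cs.inv_simple] at h
    exact h.symm
  induction ha using Subgroup.closure_induction with
  | one => exact Commute.one_left b
  | mul x y _ _ hx hy => exact hx.mul_left hy
  | inv x _ hx => exact hx.inv_left
  | mem x hx =>
    obtain ⟨j, hj, rfl⟩ := hx
    induction hb using Subgroup.closure_induction with
    | one => exact Commute.one_right _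
    | mul x y _ _ hx hy => exact hx.mul_right hy
    | inv x _ hx => exact hx.inv_right
    | mem x hx =>
      obtain ⟨i, hi, rfl⟩ := hx
      exact hs j hj i hi

lemma parabolic_mono {J K : Set B} (h : J ⊆ K) : parabolic cs J ≤ parabolic cs K :=
  Subgroup.closure_mono (Set.image_mono h)

lemma exists_mul_of_mem_parabolic_union_perp {Θ : Set B} {u : W}
    (hu : u ∈ parabolic cs (Θ ∪ perp M Θ)) :
    ∃ a ∈ parabolic cs Θ, ∃ b ∈ parabolic cs (perp M Θ), u = a * b := by
  induction hu using Subgroup.closure_induction with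
  | mem x hx =>
    obtain ⟨i, hi | hi, rfl⟩ := hx
    · exact ⟨_, simple_mem_parabolic cs hi, 1, one_mem _, by simp⟩
    · exact ⟨1, one_mem _, _, simple_mem_parabolic cs hi, by simp⟩
  | one => exact ⟨1, one_mem _, 1, one_mem _, by simp⟩
  | mul x y _ _ hx hy =>
    obtain ⟨a, ha, b, hb, rfl⟩ := hx
    obtain ⟨c, hc, d, hd, rfl⟩ := hy
    exact ⟨a * c, mul_mem ha hc, b * d, mul_mem hb hd,
      (commute_of_mem_parabolic_perp cs hc hb).symm.mul_mul_mul_comm a d⟩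
  | inv x _ hx =>
    obtain ⟨a, ha, b, hb, rfl⟩ := hx
    refine ⟨a⁻¹, inv_mem ha, b⁻¹, inv_mem hb, ?_⟩
    rw [(commute_of_mem_parabolic_perp cs ha hb).eq, mul_inv_rev]

lemma conj_mem_parabolic {Θ : Set B} {u g : W} (hu : u ∈ parabolic cs (Θ ∪ perp M Θ))
    (hg : g ∈ parabolic cs Θ) : u⁻¹ * g * u ∈ parabolic cs Θ := by
  obtain ⟨a, ha, b, hb, rfl⟩ := exists_mul_of_mem_parabolic_union_perp cs hu
  have h : a⁻¹ * g * a ∈ parabolic cs Θ := mul_mem (mul_mem (inv_mem ha) hg) ha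
  have hc : b⁻¹ * (a⁻¹ * g * a) * b = a⁻¹ * g * a := by
    rw [mul_assoc, (commute_of_mem_parabolic_perp cs h hb).eq, inv_mul_cancel_left]
  have : (a * b)⁻¹ * g * (a * b) = b⁻¹ * (a⁻¹ * g * a) * b := by group
  rwa [this, hc]

/-- normal form III. For every `∼_Θ`-class there are unique
`w₁ ∈ W^{Θ∪Θ^⊥}`, `w₂ ∈ W_{Θ^⊥}`, `w₃ ∈ ^{Θ∪Θ^⊥}W` with `(w₁w₂, w₃)` in the class;
moreover `(w₁w₂, w₃) ∼_Θ (w₁, w₂w₃)`. -/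
theorem statement4 [Finite B] (Θ : Set B) (p : W × W) :
    ∃! t : W × W × W,
      t.1 ∈ minRight cs (Θ ∪ perp M Θ) ∧ t.2.1 ∈ parabolic cs (perp M Θ) ∧
      t.2.2 ∈ minLeft cs (Θ ∪ perp M Θ) ∧
      simRel cs Θ p (t.1 * t.2.1, t.2.2) ∧
      simRel cs Θ (t.1 * t.2.1, t.2.2) (t.1, t.2.1 * t.2.2) := by
  obtain ⟨x, y⟩ := p
  have hΘ := parabolic_mono cs (Set.subset_union_left : Θ ⊆ Θ ∪ perp M Θ)
  have hP := parabolic_mono cs (Set.subset_union_right : perp M Θ ⊆ Θ ∪ perp M Θ)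
  apply existsUnique_of_exists_of_unique
  · obtain ⟨w₁, hw₁, a, ha, rfl⟩ := exists_mul_of_minRight cs (Θ ∪ perp M Θ) x
    obtain ⟨b, hb, w₃, hw₃, rfl⟩ := exists_mul_of_minLeft cs (Θ ∪ perp M Θ) y
    obtain ⟨a₁, ha₁, a₂, ha₂, rfl⟩ := exists_mul_of_mem_parabolic_union_perp cs ha
    obtain ⟨b₁, hb₁, b₂, hb₂, rfl⟩ := exists_mul_of_mem_parabolic_union_perp cs hb
    refine ⟨(w₁, a₂ * b₂, w₃), hw₁, mul_mem ha₂ hb₂, hw₃, ?_, ?_⟩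
    · refine ⟨(a₁ * a₂)⁻¹ * (a₂ * b₂), mul_mem (inv_mem ha) (hP (mul_mem ha₂ hb₂)),
        a₁⁻¹ * b₁⁻¹, mul_mem (inv_mem ha₁) (inv_mem hb₁), by simp [mul_assoc], ?_⟩
      have h₁ : a₂ * (a₁⁻¹ * b₁⁻¹) = a₁⁻¹ * b₁⁻¹ * a₂ :=
        (commute_of_mem_parabolic_perp cs (mul_mem (inv_mem ha₁) (inv_mem hb₁)) ha₂).symm.eq
      calc w₃ = (a₂ * b₂)⁻¹ * a₁ * (a₁⁻¹ * b₁⁻¹ * a₂) * (b₁ * b₂ * w₃) := by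
            rw [show a₁⁻¹ * b₁⁻¹ * a₂ = a₁⁻¹ * (b₁⁻¹ * a₂) from mul_assoc _ _ _,
              (commute_of_mem_parabolic_perp cs (inv_mem hb₁) ha₂).eq]
            group
        _ = _ := by
          rw [← h₁]
          group
    · exact ⟨(a₂ * b₂)⁻¹, hP (inv_mem (mul_mem ha₂ hb₂)), 1, one_mem _,
        (mul_inv_cancel_right _ _).symm, by simp⟩
  · rintro ⟨w₁, w₂, w₃⟩ ⟨v₁, v₂, v₃⟩ ⟨hw₁, hw₂, hw₃, ⟨u, hu, v, hv, h₁, h₂⟩, -⟩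
      ⟨hv₁, hv₂, hv₃, ⟨u', hu', v', hv', h₁', h₂'⟩, -⟩
    dsimp only at hw₁ hw₂ hw₃ h₁ h₂ hv₁ hv₂ hv₃ h₁' h₂'
    have e₁ : w₁ = v₁ := by
      refine eq_of_mem_minRight cs hw₁ hv₁ ?_
      have : w₁⁻¹ * v₁ = w₂ * u⁻¹ * u' * v₂⁻¹ := by
        rw [eq_mul_inv_of_mul_eq h₁, eq_mul_inv_of_mul_eq h₁']
        group
      rw [this]
      exact mul_mem (mul_mem (mul_mem (hP hw₂) (inv_mem hu)) hu') (inv_mem (hP hv₂))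
    have e₃ : w₃ = v₃ := by
      refine eq_of_mem_minLeft cs hw₃ hv₃ ?_
      have : w₃ * v₃⁻¹ = u⁻¹ * v * (u'⁻¹ * v')⁻¹ := by
        rw [h₂, h₂']
        group
      rw [this]
      exact mul_mem (mul_mem (inv_mem hu) (hΘ hv)) (inv_mem (mul_mem (inv_mem hu') (hΘ hv')))
    subst e₁ e₃
    have e₂ : w₂⁻¹ * v₂ = u⁻¹ * u' := by
      rw [eq_inv_mul_of_mul_eq h₁, eq_inv_mul_of_mul_eq h₁']
      group
    have e₄ : u' * u⁻¹ = v' * v⁻¹ := by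
      have : u⁻¹ * v = u'⁻¹ * v' := mul_right_cancel (h₂.symm.trans h₂')
      rw [eq_mul_inv_iff_mul_eq, mul_assoc, this, mul_inv_cancel_left]
    have e₅ : u⁻¹ * u' ∈ parabolic cs Θ := by
      have h := conj_mem_parabolic cs hu (mul_mem hv' (inv_mem hv))
      rw [← e₄] at h
      simpa [mul_assoc] using h
    have e₆ := eq_one_of_mem_parabolic_of_disjoint cs (disjoint_perp M Θ) e₅
      (e₂ ▸ mul_mem (inv_mem hw₂) hv₂)
    rw [← e₂, inv_mul_eq_one] at e₆
    rw [e₆]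

end Paper
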